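/- Let f(s) = s² + f₂(s) with f₂ : ℝ → ℝ of class C² and f₂(s)/s² → 0 as s → 0. Let u be a solution of ∂ₜu + ∂ₓ(∂ₓ²u + f(u)) = 0, sufficiently regular (C¹ in t, C³ in x, with u(t,·), ∂ₓu(t,·) ∈ L² and the decay in x needed for the virial identities), with sup over t of ∫_ℝ |u(t,x)| dx < ∞ and sup over t of ‖u(t,·)‖_{H¹} < ε for ε > 0 sufficiently small. Then for any constant C > 0, with I(t) = (−C|t|^{1/2}/log|t|, C|t|^{1/2}/log|t|) for |t| ≥ 2, one has ∫_{I(t)} u²(t,x) dx → 0 as t → +∞ (and likewise as t → −∞). -/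

import Mathlib

open MeasureTheory Filter Topology

/-- The scaling function λ(t) = |t|^{1/2}/log |t|. -/
noncomputable def lam (t : ℝ) : ℝ := Real.sqrt |t| / Real.log |t|

/-- If `p`, `q`, `j` satisfy the differential inequalities of the coupled virial argument up to
the integrable error `K / (s log² s)`, then `j` tends to zero. -/
lemma tendsto_zero_of_virial_inequalities {p q j p' q' j' a b : ℝ → ℝ} {T K : ℝ} (hT : 9 ≤ T)
    (hK : 0 ≤ K)
    (hp : ∀ s, T < s → HasDerivAt p (p' s) s) (hq : ∀ s, T < s → HasDerivAt q (q' s) s)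
    (hj : ∀ s, T < s → HasDerivAt j (j' s) s)
    (hlog : ∀ s, T < s → 1 ≤ Real.log s)
    (hb : ∀ s, T < s → 0 ≤ b s)
    (hp' : ∀ s, T < s → (1 / 4) * a s - K / (s * Real.log s ^ 2) ≤ p' s)
    (hq' : ∀ s, T < s → q' s ≤ -(3 / 2) * b s + K * a s + K / (s * Real.log s ^ 2))
    (hj' : ∀ s, T < s → |j' s| ≤ K * a s + K * b s + K / (s * Real.log s ^ 2))
    (hpK : ∀ s, T < s → |p s| ≤ K) (hqK : ∀ s, T < s → |q s| ≤ K)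
    (hj0 : ∀ s, T < s → 0 ≤ j s) (hjK : ∀ s, T < s → j s ≤ K)
    (hja : ∀ s, T < s → j s / Real.sqrt s ≤ a s) :
    Tendsto j atTop (𝓝 0) := by
  have mono : ∀ h h' : ℝ → ℝ, ∀ S, (∀ s, S < s → HasDerivAt h (h' s) s) →
      (∀ s, S < s → 0 ≤ h' s) → MonotoneOn h (Set.Ioi S) := by
    intro h h' S hd hn
    refine monotoneOn_of_deriv_nonneg (convex_Ioi S)
      (fun s hs => (hd s hs).continuousAt.continuousWithinAt)
      (fun s hs => (hd s (interior_subset hs)).differentiableAt.differentiableWithinAt)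
      (fun s hs => ?_)
    rw [(hd s (interior_subset hs)).deriv]
    exact hn s (interior_subset hs)
  have conv : ∀ h h' : ℝ → ℝ, ∀ S D, (∀ s, S < s → HasDerivAt h (h' s) s) →
      (∀ s, S < s → 0 ≤ h' s) → (∀ s, S < s → h s ≤ D) → ∃ l, Tendsto h atTop (𝓝 l) := by
    intro h h' S D hd hn hD
    have hm : Monotone (fun s => h (max s (S + 1))) := fun x y hxy =>
      mono h h' S hd hn (lt_of_lt_of_le (lt_add_one S) (le_max_right _ _))
        (lt_of_lt_of_le (lt_add_one S) (le_max_right _ _)) (max_le_max_right _ hxy)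
    have hB : BddAbove (Set.range (fun s => h (max s (S + 1)))) :=
      ⟨D, by rintro _ ⟨s, rfl⟩; exact hD _ (lt_of_lt_of_le (lt_add_one S) (le_max_right _ _))⟩
    refine ⟨_, (tendsto_atTop_ciSup hm hB).congr' ?_⟩
    filter_upwards [eventually_ge_atTop (S + 1)] with s hs
    rw [max_eq_left hs]
  have hG : ∀ s, T < s →
      HasDerivAt (fun s => -(Real.log s)⁻¹) (1 / (s * Real.log s ^ 2)) s := by
    intro s hs
    have h1 := hlog s hs
    have h := ((Real.hasDerivAt_log (by linarith : s ≠ 0)).inv (by linarith)).neg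
    refine h.congr_deriv ?_
    rw [one_div, mul_inv]
    ring
  have hGb : ∀ s, T < s → |-(Real.log s)⁻¹| ≤ 1 := by
    intro s hs
    have h1 := hlog s hs
    rw [abs_neg, abs_of_nonneg (by positivity)]
    exact inv_le_one_of_one_le₀ h1
  have hg0 : ∀ s, T < s → 0 ≤ 1 / (s * Real.log s ^ 2) := by
    intro s hs
    have : 0 < s := by linarith
    positivity
  set α := 4 * (K + K * K) with hα
  set E := K * (1 + α + K) with hE
  have hα0 : 0 ≤ α := by positivity
  have hE0 : 0 ≤ E := by positivity
  have key : ∀ s, T < s →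
      |j' s| ≤ α * p' s - K * q' s + E * (1 / (s * Real.log s ^ 2)) := by
    intro s hs
    have e1 := mul_le_mul_of_nonneg_left (hp' s hs) hα0
    have e2 := mul_le_mul_of_nonneg_left (hq' s hs) hK
    have e3 := hj' s hs
    have e4 := mul_nonneg hK (hb s hs)
    have e5 : K / (s * Real.log s ^ 2) = K * (1 / (s * Real.log s ^ 2)) := by ring
    rw [e5] at e1 e2 e3
    simp only [hE]
    nlinarith
  have hbd : ∀ s, T < s → |α * p s - K * q s + E * -(Real.log s)⁻¹| ≤ α * K + K * K + E := by
    intro s hs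
    have e1 := abs_le.1 (hpK s hs)
    have e2 := abs_le.1 (hqK s hs)
    have e3 := abs_le.1 (hGb s hs)
    rw [abs_le]
    constructor <;> nlinarith
  have hR : ∀ s, T < s → HasDerivAt (fun s => α * p s - K * q s + E * -(Real.log s)⁻¹)
      (α * p' s - K * q' s + E * (1 / (s * Real.log s ^ 2))) s := fun s hs =>
    (((hp s hs).const_mul α).sub ((hq s hs).const_mul K)).add ((hG s hs).const_mul E)
  obtain ⟨l₁, hl₁⟩ := conv _ _ T (K + (α * K + K * K + E)) (fun s hs => (hj s hs).add (hR s hs))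
    (fun s hs => by linarith [key s hs, neg_abs_le (j' s)])
    (fun s hs => add_le_add (hjK s hs) (le_of_abs_le (hbd s hs)))
  obtain ⟨l₂, hl₂⟩ := conv _ _ T (0 + (α * K + K * K + E))
    (fun s hs => (hj s hs).neg.add (hR s hs))
    (fun s hs => by linarith [key s hs, le_abs_self (j' s)])
    (fun s hs => add_le_add (by simpa using hj0 s hs) (le_of_abs_le (hbd s hs)))
  have hjl : Tendsto j atTop (𝓝 ((l₁ - l₂) / 2)) := by
    refine ((hl₁.sub hl₂).div_const 2).congr fun s => ?_
    simp only [Pi.add_apply, Pi.neg_apply]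
    ring
  set L := (l₁ - l₂) / 2
  have hL0 : 0 ≤ L :=
    ge_of_tendsto hjl (by filter_upwards [eventually_gt_atTop T] with s hs using hj0 s hs)
  rcases hL0.eq_or_lt with h | hL
  · rwa [← h] at hjl
  exfalso
  obtain ⟨S, hS⟩ := eventually_atTop.1
    ((eventually_gt_atTop T).and (hjl.eventually_const_lt (by linarith : L / 2 < L)))
  have hST : ∀ s, S < s → T < s := fun s hs => (hS s hs.le).1
  obtain ⟨l, hl⟩ := conv (fun s => p s + K * -(Real.log s)⁻¹ + -(L / 4) * Real.sqrt s) _ S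
    (K + K + 0)
    (fun s hs => ((hp s (hST s hs)).add ((hG s (hST s hs)).const_mul K)).add
      ((Real.hasDerivAt_sqrt (by linarith [hST s hs] : s ≠ 0)).const_mul (-(L / 4))))
    (fun s hs => by
      have hs0 : 0 < Real.sqrt s := Real.sqrt_pos.2 (by linarith [hST s hs])
      have e1 := hp' s (hST s hs)
      have e2 := hja s (hST s hs)
      have e3 : L / 2 / Real.sqrt s ≤ j s / Real.sqrt s := by
        gcongr; exact (hS s hs.le).2.le
      have e4 : -(L / 4) * (1 / (2 * Real.sqrt s)) = -(1 / 4) * (L / 2 / Real.sqrt s) := by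
        field_simp
      have e5 : K / (s * Real.log s ^ 2) = K * (1 / (s * Real.log s ^ 2)) := by ring
      rw [e4]
      linarith)
    (fun s hs => by
      have e1 := abs_le.1 (hpK s (hST s hs))
      have e2 := abs_le.1 (hGb s (hST s hs))
      have e3 := Real.sqrt_nonneg s
      nlinarith)
  have hatBot : Tendsto (fun s => p s + K * -(Real.log s)⁻¹ + -(L / 4) * Real.sqrt s) atTop
      atBot := by
    refine tendsto_atBot_mono' _ (?_ : ∀ᶠ s in atTop, _ ≤ K + K + -(L / 4) * Real.sqrt s) ?_
    · filter_upwards [eventually_gt_atTop T] with s hs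
      have e1 := abs_le.1 (hpK s hs)
      have e2 := abs_le.1 (hGb s hs)
      nlinarith
    · exact tendsto_atBot_add_const_left _ _
        (Real.tendsto_sqrt_atTop.const_mul_atTop_of_neg (by linarith))
  exact not_tendsto_nhds_of_tendsto_atBot hatBot l hl

lemma lam_neg (t : ℝ) : lam (-t) = lam t := by simp [lam]

lemma deriv_lam_neg (t : ℝ) : deriv lam (-t) = -deriv lam t := by
  have h := deriv_comp_neg lam t
  simp only [lam_neg] at h
  exact (neg_eq_iff_eq_neg.2 h).symm

lemma hasDerivAt_lam {s : ℝ} (hs : 1 < s) :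
    HasDerivAt lam ((1 / 2 - 1 / Real.log s) / (Real.sqrt s * Real.log s)) s := by
  have hlog : 0 < Real.log s := Real.log_pos hs
  have hsq : 0 < Real.sqrt s := Real.sqrt_pos.2 (by linarith)
  have h := (Real.hasDerivAt_sqrt (by linarith : s ≠ 0)).div
    (Real.hasDerivAt_log (by linarith : s ≠ 0)) hlog.ne'
  have heq : lam =ᶠ[𝓝 s] (Real.sqrt / Real.log) := by
    filter_upwards [lt_mem_nhds hs] with t ht
    simp [lam, abs_of_pos (by linarith : (0 : ℝ) < t)]
  refine (h.congr_of_eventuallyEq heq).congr_deriv ?_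
  have e : s = Real.sqrt s * Real.sqrt s := (Real.mul_self_sqrt (by linarith)).symm
  have e2 : s⁻¹ = (Real.sqrt s)⁻¹ * (Real.sqrt s)⁻¹ := by rw [← mul_inv, ← e]
  rw [e2]
  field_simp

lemma exists_lam_bounds : ∃ T : ℝ, 9 ≤ T ∧ ∀ s, T < s → 1 ≤ Real.log s ∧ 0 < lam s ∧
    lam s ≤ Real.sqrt s ∧ |deriv lam s| ≤ 1 ∧
    deriv lam s ^ 2 ≤ 3 * (1 / (s * Real.log s ^ 2)) ∧
    1 / lam s ^ 3 ≤ 1 / (s * Real.log s ^ 2) := by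
  have hO := (isLittleO_log_rpow_rpow_atTop 5 (by norm_num : (0 : ℝ) < 1 / 2)).bound
    (zero_lt_one)
  obtain ⟨T, hT⟩ := eventually_atTop.1 hO
  refine ⟨max T 9, le_max_right _ _, fun s hs => ?_⟩
  have hs9 : 9 < s := (le_max_right _ _).trans_lt hs
  have hpow := hT s ((le_max_left _ _).trans hs.le)
  have hlog : 1 ≤ Real.log s := by
    rw [Real.le_log_iff_exp_le (by linarith)]
    linarith [Real.exp_one_lt_d9]
  have hsq : 3 ≤ Real.sqrt s := Real.le_sqrt_of_sq_le (by linarith)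
  have hss : Real.sqrt s ^ 2 = s := Real.sq_sqrt (by linarith)
  have hlam : lam s = Real.sqrt s / Real.log s := by
    simp [lam, abs_of_pos (by linarith : (0 : ℝ) < s)]
  have hinv : 0 < 1 / Real.log s ∧ 1 / Real.log s ≤ 1 :=
    ⟨by positivity, (div_le_one (by linarith)).2 hlog⟩
  have hnum : |1 / 2 - 1 / Real.log s| ≤ 1 := by rw [abs_le]; constructor <;> linarith
  rw [← Real.sqrt_eq_rpow, Real.norm_of_nonneg (by positivity),
    Real.norm_of_nonneg (by positivity), one_mul,
    show (5 : ℝ) = ((5 : ℕ) : ℝ) by norm_num, Real.rpow_natCast] at hpow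
  refine ⟨hlog, ?_, ?_, ?_, ?_, ?_⟩
  · rw [hlam]; positivity
  · rw [hlam]; exact div_le_self (by linarith) hlog
  · rw [(hasDerivAt_lam (by linarith)).deriv, abs_div,
      abs_of_pos (by positivity : 0 < Real.sqrt s * Real.log s)]
    exact div_le_one_of_le₀ (by nlinarith) (by positivity)
  · rw [(hasDerivAt_lam (by linarith)).deriv, div_pow, mul_pow, hss, div_eq_mul_one_div]
    gcongr
    exact ((sq_le_one_iff_abs_le_one _).2 hnum).trans (by norm_num)
  · rw [hlam, div_pow, one_div_div, div_le_div_iff₀ (by positivity) (by positivity)]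
    calc Real.log s ^ 3 * (s * Real.log s ^ 2) = Real.log s ^ 5 * s := by ring
      _ ≤ Real.sqrt s * s := by gcongr
      _ = 1 * Real.sqrt s ^ 3 := by rw [pow_succ _ 2, hss]; ring

/-- Primitive of a bump function together with a smaller bump function, with the bounds needed
to use them as virial weights. -/
lemma exists_virial_weights {C : ℝ} (hC : 0 < C) : ∃ ψ χ : ℝ → ℝ, ∃ K : ℝ, 0 ≤ K ∧
    ContDiff ℝ 3 ψ ∧ ContDiff ℝ 3 χ ∧
    (∀ n ≤ 3, ∀ x, |iteratedDeriv n ψ x| ≤ K) ∧ (∀ n ≤ 3, ∀ x, |iteratedDeriv n χ x| ≤ K) ∧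
    HasCompactSupport (deriv ψ) ∧ (∀ y, 0 ≤ deriv ψ y) ∧ (∀ y, deriv ψ y ≤ 1) ∧
    (∀ y, |y| * deriv ψ y ≤ K * deriv ψ y) ∧
    (∀ y, 0 ≤ χ y) ∧ (∀ y, χ y ≤ deriv ψ y) ∧ (∀ y, |y| < C → χ y = 1) ∧
    (∀ y, |deriv χ y| ≤ K * deriv ψ y) := by
  let w : ContDiffBump (0 : ℝ) := ⟨2 * C, 3 * C, by linarith, by linarith⟩
  let χ : ContDiffBump (0 : ℝ) := ⟨C, 2 * C, hC, by linarith⟩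
  have hwc : ContDiff ℝ 3 w := w.contDiff (n := 3)
  have hχc : ContDiff ℝ 3 χ := χ.contDiff (n := 3)
  have hws := w.hasCompactSupport
  have hχs := χ.hasCompactSupport
  set ψ : ℝ → ℝ := fun x => ∫ y in (0 : ℝ)..x, w y with hψ
  have hd : ∀ x, HasDerivAt ψ (w x) x := fun x =>
    (hwc.continuous.integral_hasStrictDerivAt 0 x).hasDerivAt
  have hdψ : deriv ψ = w := funext fun x => (hd x).deriv
  have hψc : ContDiff ℝ 3 ψ := by
    rw [show (3 : WithTop ℕ∞) = 2 + 1 by norm_num, contDiff_succ_iff_deriv]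
    refine ⟨fun x => (hd x).differentiableAt, by simp, ?_⟩
    rw [hdψ]
    exact w.contDiff (n := 2)
  have bound : ∀ g : ℝ → ℝ, ContDiff ℝ 3 g → HasCompactSupport g →
      ∃ D, ∀ n ≤ 3, ∀ x, |iteratedDeriv n g x| ≤ D := by
    intro g hg hgs
    have hs : ∀ n, HasCompactSupport (iteratedDeriv n g) := by
      intro n
      induction n with
      | zero => simpa using hgs
      | succ k ih => rw [iteratedDeriv_succ]; exact ih.deriv
    have hcn : ∀ n ≤ 3, ∃ D, ∀ x, ‖iteratedDeriv n g x‖ ≤ D := fun n hn =>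
      (hs n).exists_bound_of_continuous (hg.continuous_iteratedDeriv n (by exact_mod_cast hn))
    obtain ⟨D0, h0⟩ := hcn 0 (by norm_num)
    obtain ⟨D1, h1⟩ := hcn 1 (by norm_num)
    obtain ⟨D2, h2⟩ := hcn 2 (by norm_num)
    obtain ⟨D3, h3⟩ := hcn 3 (by norm_num)
    refine ⟨max (max D0 D1) (max D2 D3), fun n hn x => ?_⟩
    interval_cases n
    · exact (h0 x).trans (by simp)
    · exact (h1 x).trans (by simp)
    · exact (h2 x).trans (by simp)
    · exact (h3 x).trans (by simp)
  obtain ⟨D₁, hD₁⟩ := bound w hwc hws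
  obtain ⟨D₂, hD₂⟩ := bound χ hχc hχs
  set I := ∫ y, ‖w y‖
  have hI : 0 ≤ I := integral_nonneg fun _ => norm_nonneg _
  have hwi : Integrable (w : ℝ → ℝ) := hwc.continuous.integrable_of_hasCompactSupport hws
  have hψb : ∀ x, |ψ x| ≤ I := fun x =>
    (intervalIntegral.norm_integral_le_integral_norm_uIoc).trans
      (setIntegral_le_integral hwi.norm (ae_of_all _ fun _ => norm_nonneg _))
  have hD₁0 : 0 ≤ D₁ := (abs_nonneg _).trans (hD₁ 0 (by norm_num) 0)
  have hD₂0 : 0 ≤ D₂ := (abs_nonneg _).trans (hD₂ 0 (by norm_num) 0)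
  have hK : 0 ≤ I + D₁ + D₂ + 3 * C := by positivity
  refine ⟨ψ, χ, I + D₁ + D₂ + 3 * C, hK, hψc, hχc, ?_, ?_, ?_, ?_, ?_, ?_, fun y => χ.nonneg,
    ?_, ?_, ?_⟩
  · intro n hn x
    rcases n with _ | n
    · simpa using (hψb x).trans (by linarith)
    · rw [iteratedDeriv_succ', hdψ]
      exact (hD₁ n (by omega) x).trans (by linarith)
  · intro n hn x
    exact (hD₂ n hn x).trans (by linarith)
  · rwa [hdψ]
  · intro y; rw [hdψ]; exact w.nonneg
  · intro y; rw [hdψ]; exact w.le_one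
  · intro y
    rw [hdψ]
    by_cases h : 3 * C ≤ |y|
    · rw [w.zero_of_le_dist (by simpa using h)]; simp
    · exact mul_le_mul_of_nonneg_right (by linarith [not_le.1 h]) w.nonneg
  · intro y
    rw [hdψ]
    by_cases h : 2 * C ≤ |y|
    · rw [χ.zero_of_le_dist (by simpa using h)]; exact w.nonneg
    · rw [w.one_of_mem_closedBall (by simpa using (not_le.1 h).le)]; exact χ.le_one
  · intro y hy
    exact χ.one_of_mem_closedBall (by simpa using hy.le)
  · intro y
    rw [hdψ]
    by_cases h : 2 * C < |y|
    · have : (χ : ℝ → ℝ) =ᶠ[𝓝 y] fun _ => 0 := by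
        filter_upwards [(isOpen_lt continuous_const continuous_abs).mem_nhds h] with z hz
        exact χ.zero_of_le_dist (by simpa using (le_of_lt hz))
      rw [this.deriv_eq]
      simpa using mul_nonneg hK w.nonneg
    · rw [w.one_of_mem_closedBall (by simpa using not_lt.1 h), mul_one]
      have := hD₂ 1 (by norm_num) y
      rw [iteratedDeriv_one] at this
      exact this.trans (by linarith)

lemma sq_le_integral_sq_add_deriv_sq {v : ℝ → ℝ} (hv : ContDiff ℝ 1 v)
    (h2 : Integrable fun x => v x ^ 2) (hd2 : Integrable fun x => deriv v x ^ 2) (x : ℝ) :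
    v x ^ 2 ≤ ∫ y, (v y ^ 2 + deriv v y ^ 2) := by
  have hd : ∀ y, HasDerivAt (fun y => v y ^ 2) (2 * v y * deriv v y) y := fun y => by
    refine ((hv.differentiable (by norm_num) y).hasDerivAt.pow 2).congr_deriv ?_
    simp
  have hle : ∀ y, ‖2 * v y * deriv v y‖ ≤ v y ^ 2 + deriv v y ^ 2 := fun y => by
    rw [Real.norm_eq_abs, abs_le]
    constructor <;> nlinarith [sq_nonneg (v y - deriv v y), sq_nonneg (v y + deriv v y)]
  have hsum : Integrable fun y => v y ^ 2 + deriv v y ^ 2 := h2.add hd2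
  have hint : Integrable fun y => 2 * v y * deriv v y :=
    hsum.mono' ((hv.continuous.const_smul (2 : ℝ)).mul
      (hv.continuous_deriv le_rfl)).aestronglyMeasurable (ae_of_all _ hle)
  have hlim := tendsto_zero_of_hasDerivAt_of_integrableOn_Iic (a := x) (fun y _ => hd y)
    hint.integrableOn h2.integrableOn
  have hFTC := integral_Iic_of_hasDerivAt_of_tendsto (hd x).continuousAt.continuousWithinAt
    (fun y _ => hd y) hint.integrableOn hlim
  rw [sub_zero] at hFTC
  rw [← hFTC]
  calc ∫ y in Set.Iic x, 2 * v y * deriv v y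
      ≤ ∫ y in Set.Iic x, (v y ^ 2 + deriv v y ^ 2) :=
        integral_mono hint.integrableOn hsum.integrableOn fun y => le_of_abs_le (hle y)
    _ ≤ ∫ y, (v y ^ 2 + deriv v y ^ 2) :=
        setIntegral_le_integral hsum (ae_of_all _ fun y => by positivity)

lemma abs_integral_le_integral {F G : ℝ → ℝ} (hG : Integrable G) (h : ∀ x, |F x| ≤ G x) :
    |∫ x, F x| ≤ ∫ x, G x :=
  norm_integral_le_of_norm_le (f := F) hG (ae_of_all _ h)

lemma abs_integral_le_of_bounded {θ g : ℝ → ℝ} {l K : ℝ} (hθ : ∀ y, |θ y| ≤ K)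
    (hg : Integrable g) : |∫ x, θ (x / l) * g x| ≤ K * ∫ x, |g x| := by
  rw [← integral_const_mul]
  refine abs_integral_le_integral (hg.abs.const_mul K) fun x => ?_
  rw [abs_mul]
  gcongr
  exact hθ _

lemma integrable_weight_mul {w g : ℝ → ℝ} {l : ℝ} (hw : Continuous w) (h0 : ∀ y, 0 ≤ w y)
    (h1 : ∀ y, w y ≤ 1) (hg : Integrable g) : Integrable fun x => w (x / l) * g x :=
  hg.bdd_mul (c := 1) (hw.comp (continuous_id.div_const l)).aestronglyMeasurable
    (ae_of_all _ fun x => by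
      simpa [abs_of_nonneg (h0 (x / l))] using h1 (x / l))

lemma linear_flux_lower_bound {w w₃ v f2 : ℝ → ℝ} {l m M K : ℝ} (hw : Continuous w)
    (hwc : HasCompactSupport w) (h0 : ∀ y, 0 ≤ w y) (h1 : ∀ y, w y ≤ 1)
    (hK : 0 ≤ K) (hw₃ : ∀ y, |w₃ y| ≤ K) (hl : 0 < l) (hvc : Continuous v) (hv : Integrable v)
    (hv2 : Integrable fun x => v x ^ 2) (hM : (∫ x, |v x|) ≤ M) (hf2c : Continuous f2)
    (hf2 : ∀ x, |f2 (v x)| ≤ v x ^ 2 / 2) :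
    (1 / 4) * ((∫ x, w (x / l) * v x ^ 2) / l) - (m ^ 2 * (∫ y, w y * y ^ 2) + K * M / l ^ 3) ≤
      -(m / l) * (∫ x, (x / l) * w (x / l) * v x) + (1 / l ^ 3) * (∫ x, w₃ (x / l) * v x)
        + (1 / l) * ∫ x, w (x / l) * (v x ^ 2 + f2 (v x)) := by
  have hiA := integrable_weight_mul (l := l) hw h0 h1 hv2
  set A := ∫ x, w (x / l) * v x ^ 2 with hA
  have hiW : Integrable fun y => w y * y ^ 2 :=
    (hw.mul (continuous_pow 2)).integrable_of_hasCompactSupport hwc.mul_right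
  have hWl : ∫ x, w (x / l) * (x / l) ^ 2 = l * ∫ y, w y * y ^ 2 := by
    have := Measure.integral_comp_div (fun y => w y * y ^ 2) l
    rwa [abs_of_pos hl, smul_eq_mul] at this
  have hiWl : Integrable fun x => w (x / l) * (x / l) ^ 2 := hiW.comp_div hl.ne'
  have hiN : Integrable fun x => v x ^ 2 + f2 (v x) := by
    refine hv2.add ((hv2.div_const 2).mono' (hf2c.comp hvc).aestronglyMeasurable
      (ae_of_all _ hf2))
  have e1 : |(m / l) * ∫ x, (x / l) * w (x / l) * v x| ≤
      (1 / 4) * (A / l) + m ^ 2 * ∫ y, w y * y ^ 2 := by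
    rw [← integral_const_mul]
    have := abs_integral_le_integral (F := fun x => (m / l) * ((x / l) * w (x / l) * v x))
      ((hiA.const_mul (1 / (4 * l))).add (hiWl.const_mul (m ^ 2 / l))) fun x => ?_
    · refine this.trans_eq ?_
      simp only [Pi.add_apply]
      rw [integral_add (hiA.const_mul _) (hiWl.const_mul _), integral_const_mul,
        integral_const_mul, hWl, ← hA]
      field_simp
    · have hw0 := h0 (x / l)
      have : |m * (x / l) * v x| ≤ v x ^ 2 / 4 + m ^ 2 * (x / l) ^ 2 := by
        rw [abs_le]
        constructor <;> nlinarith [sq_nonneg (v x / 2 - m * (x / l)),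
          sq_nonneg (v x / 2 + m * (x / l))]
      calc |m / l * (x / l * w (x / l) * v x)| = |w (x / l) / l * (m * (x / l) * v x)| := by
            congr 1; ring
        _ = w (x / l) / l * |m * (x / l) * v x| := by
            rw [abs_mul, abs_of_nonneg (by positivity : 0 ≤ w (x / l) / l)]
        _ ≤ w (x / l) / l * (v x ^ 2 / 4 + m ^ 2 * (x / l) ^ 2) := by gcongr
        _ = _ := by simp only [Pi.add_apply]; field_simp
  have e2 : |∫ x, w₃ (x / l) * v x| ≤ K * M :=
    (abs_integral_le_of_bounded hw₃ hv).trans (by gcongr)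
  have e3 : A / 2 ≤ ∫ x, w (x / l) * (v x ^ 2 + f2 (v x)) := by
    rw [hA, ← integral_div]
    refine integral_mono (hiA.div_const 2) (integrable_weight_mul hw h0 h1 hiN) fun x => ?_
    have := (abs_le.1 (hf2 x)).1
    have := mul_nonneg (h0 (x / l)) (by linarith : 0 ≤ v x ^ 2 + f2 (v x) - v x ^ 2 / 2)
    simp only
    linarith
  have e4 : (1 / l ^ 3) * (-(K * M)) ≤ (1 / l ^ 3) * ∫ x, w₃ (x / l) * v x :=
    mul_le_mul_of_nonneg_left (abs_le.1 e2).1 (by positivity)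
  have e5 : (1 / l) * (A / 2) ≤ (1 / l) * ∫ x, w (x / l) * (v x ^ 2 + f2 (v x)) :=
    mul_le_mul_of_nonneg_left e3 (by positivity)
  have e6 := (abs_le.1 e1).2
  have e7 : (1 / l) * (A / 2) = (1 / 2) * (A / l) := by ring
  have e8 : (1 / l ^ 3) * (-(K * M)) = -(K * M / l ^ 3) := by ring
  linarith

lemma quadratic_flux_bound {w θ θ₂ v N : ℝ → ℝ} {l m K : ℝ} (hw : Continuous w)
    (h0 : ∀ y, 0 ≤ w y) (h1 : ∀ y, w y ≤ 1) (hK : 0 ≤ K)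
    (hwK : ∀ y, |y| * w y ≤ K * w y) (hθ : ∀ y, |θ y| ≤ (K + 1) * w y)
    (hθ₂ : ∀ y, |θ₂ y| ≤ K) (hl : 0 < l) (hm : |m| ≤ 1)
    (hv2 : Integrable fun x => v x ^ 2) (hv1 : (∫ x, v x ^ 2) ≤ 1)
    (hN : ∀ x, |N x| ≤ 2 * v x ^ 2) :
    |-(m / (2 * l)) * (∫ x, (x / l) * θ (x / l) * v x ^ 2)
        + (1 / (2 * l ^ 3)) * (∫ x, θ₂ (x / l) * v x ^ 2)
        + (1 / l) * ∫ x, θ (x / l) * N x| ≤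
      (K + 1) * (K + 2) * ((∫ x, w (x / l) * v x ^ 2) / l) + K * (1 / l ^ 3) := by
  have hiA := integrable_weight_mul (l := l) hw h0 h1 hv2
  set A := ∫ x, w (x / l) * v x ^ 2 with hA
  have hA0 : 0 ≤ A := integral_nonneg fun x => mul_nonneg (h0 _) (sq_nonneg _)
  have e1 : |∫ x, (x / l) * θ (x / l) * v x ^ 2| ≤ (K + 1) * K * A := by
    rw [hA, ← integral_const_mul]
    refine abs_integral_le_integral (hiA.const_mul _) fun x => ?_
    rw [abs_mul, abs_mul, abs_of_nonneg (sq_nonneg (v x))]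
    calc |x / l| * |θ (x / l)| * v x ^ 2 ≤ |x / l| * ((K + 1) * w (x / l)) * v x ^ 2 := by
          gcongr; exact hθ _
      _ = (K + 1) * (|x / l| * w (x / l)) * v x ^ 2 := by ring
      _ ≤ (K + 1) * (K * w (x / l)) * v x ^ 2 :=
          mul_le_mul_of_nonneg_right
            (mul_le_mul_of_nonneg_left (hwK _) (by positivity)) (sq_nonneg _)
      _ = _ := by ring
  have e2 : |∫ x, θ₂ (x / l) * v x ^ 2| ≤ K := by
    refine (abs_integral_le_integral (hv2.const_mul K) fun x => ?_).trans ?_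
    · rw [abs_mul, abs_of_nonneg (sq_nonneg (v x))]; gcongr; exact hθ₂ _
    · rw [integral_const_mul]; nlinarith
  have e3 : |∫ x, θ (x / l) * N x| ≤ 2 * (K + 1) * A := by
    rw [hA, ← integral_const_mul]
    refine abs_integral_le_integral (hiA.const_mul _) fun x => ?_
    rw [abs_mul]
    calc |θ (x / l)| * |N x| ≤ ((K + 1) * w (x / l)) * (2 * v x ^ 2) :=
          mul_le_mul (hθ _) (hN x) (abs_nonneg _) (mul_nonneg (by positivity) (h0 _))
      _ = _ := by ring
  refine (abs_add_three _ _ _).trans ?_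
  rw [abs_mul, abs_mul, abs_mul, abs_neg, abs_div, abs_of_pos (by positivity : 0 < 2 * l),
    abs_of_pos (by positivity : 0 < 1 / (2 * l ^ 3)), abs_of_pos (by positivity : 0 < 1 / l)]
  calc |m| / (2 * l) * |∫ x, (x / l) * θ (x / l) * v x ^ 2|
        + 1 / (2 * l ^ 3) * |∫ x, θ₂ (x / l) * v x ^ 2| + 1 / l * |∫ x, θ (x / l) * N x|
      ≤ 1 / (2 * l) * ((K + 1) * K * A) + 1 / (2 * l ^ 3) * K
        + 1 / l * (2 * (K + 1) * A) := by gcongr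
    _ = (K + 1) * (K / 2 + 2) * (A / l) + K / 2 * (1 / l ^ 3) := by field_simp; ring
    _ ≤ _ := by gcongr <;> linarith

lemma abs_integral_weight_le {w θ g : ℝ → ℝ} {l K : ℝ} (hw : Continuous w)
    (h0 : ∀ y, 0 ≤ w y) (h1 : ∀ y, w y ≤ 1) (hθ : ∀ y, |θ y| ≤ K * w y)
    (hg : Integrable g) (hg0 : ∀ x, 0 ≤ g x) :
    |∫ x, θ (x / l) * g x| ≤ K * ∫ x, w (x / l) * g x := by
  rw [← integral_const_mul]
  refine abs_integral_le_integral ((integrable_weight_mul hw h0 h1 hg).const_mul K)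
    fun x => ?_
  rw [abs_mul, abs_of_nonneg (hg0 x), ← mul_assoc]
  gcongr
  · exact hg0 x
  · exact hθ _

/-- A threshold below which `f₂` is dominated by `s²` and the cubic flux by `2s²`. -/
lemma exists_small_nonlinearity {f2 F2 : ℝ → ℝ} (hf2 : Continuous f2)
    (hlim : Tendsto (fun s : ℝ => f2 s / s ^ 2) (𝓝[≠] 0) (𝓝 0))
    (hF20 : F2 0 = 0) (hF2' : ∀ s : ℝ, HasDerivAt F2 (f2 s) s) :
    ∃ ε > 0, ε ≤ 1 ∧ ∀ s, |s| < ε → |f2 s| ≤ s ^ 2 / 2 ∧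
      |(2 / 3) * s ^ 3 + s * f2 s - F2 s| ≤ 2 * s ^ 2 := by
  have hz : f2 0 = 0 := by
    have h1 : Tendsto (fun s : ℝ => f2 s / s ^ 2 * s ^ 2) (𝓝[≠] 0) (𝓝 (0 * 0 ^ 2)) :=
      hlim.mul (((continuous_pow 2).tendsto 0).mono_left nhdsWithin_le_nhds)
    have h2 : Tendsto f2 (𝓝[≠] 0) (𝓝 (f2 0)) := (hf2.tendsto 0).mono_left nhdsWithin_le_nhds
    refine (tendsto_nhds_unique (h2.congr' ?_) h1).trans (by simp)
    filter_upwards [self_mem_nhdsWithin] with s hs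
    have : s ≠ 0 := hs
    field_simp
  have hev := hlim.eventually (Metric.ball_mem_nhds (0 : ℝ) (by norm_num : (0 : ℝ) < 1 / 2))
  rw [eventually_nhdsWithin_iff, Metric.eventually_nhds_iff] at hev
  obtain ⟨δ, hδ, h⟩ := hev
  have hb : ∀ s, |s| < min δ 1 → |f2 s| ≤ s ^ 2 / 2 := by
    intro s hs
    by_cases hs0 : s = 0
    · simp [hs0, hz]
    have h3 := h (by simpa using hs.trans_le (min_le_left _ _) : dist s 0 < δ) hs0
    rw [dist_zero_right, Real.norm_eq_abs, abs_div,
      abs_of_nonneg (sq_nonneg s), div_lt_iff₀ (by positivity)] at h3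
    linarith
  refine ⟨min δ 1, by positivity, min_le_right _ _, fun s hs => ⟨hb s hs, ?_⟩⟩
  have hs1 : |s| ≤ 1 := (hs.trans_le (min_le_right _ _)).le
  have hF : |F2 s| ≤ s ^ 2 / 2 * |s| := by
    have := (convex_Icc (-|s|) |s|).norm_image_sub_le_of_norm_hasDerivWithin_le (x := 0) (y := s)
      (C := s ^ 2 / 2) (fun x _ => (hF2' x).hasDerivWithinAt) (fun x hx => by
        have hx' : |x| ≤ |s| := abs_le.2 hx
        exact (hb x (hx'.trans_lt hs)).trans (by have := sq_le_sq.2 hx'; linarith))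
      (by simp) (abs_le.1 le_rfl)
    simpa [hF20] using this
  have e1 : |(2 / 3) * s ^ 3| ≤ (2 / 3) * s ^ 2 := by
    rw [abs_mul, abs_pow, abs_of_pos (by norm_num : (0 : ℝ) < 2 / 3), ← sq_abs s]
    have := mul_le_mul_of_nonneg_left hs1 (sq_nonneg |s|)
    nlinarith
  have e2 : |s * f2 s| ≤ s ^ 2 / 2 := by
    rw [abs_mul]
    exact (mul_le_mul hs1 (hb s hs) (abs_nonneg _) zero_le_one).trans (by simp)
  have e3 : |F2 s| ≤ s ^ 2 / 2 := hF.trans (mul_le_of_le_one_right (by positivity) hs1)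
  rw [abs_le] at *
  constructor <;> nlinarith [sq_nonneg s]

/-- Local L² decay: for small solutions of
`∂ₜu + ∂ₓ(∂ₓ²u + u² + f₂(u)) = 0`, bounded in L¹ uniformly in time,
`∫_{I(t)} u²(t,x) dx → 0` as `t → ±∞`, where
`I(t) = (−C|t|^{1/2}/log|t|, C|t|^{1/2}/log|t|)`. -/
theorem gkdv_local_L2_decay
    (f2 : ℝ → ℝ) (hf2 : ContDiff ℝ 2 f2)
    (hlim : Tendsto (fun s : ℝ => f2 s / s ^ 2) (𝓝[≠] 0) (𝓝 0))
    (F2 : ℝ → ℝ) (hF20 : F2 0 = 0) (hF2' : ∀ s : ℝ, HasDerivAt F2 (f2 s) s) :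
    ∃ ε > 0, ∀ u : ℝ → ℝ → ℝ,
      (∀ x, ContDiff ℝ 1 (fun t => u t x)) →
      (∀ t, ContDiff ℝ 3 (fun x => u t x)) →
      (∀ t x, deriv (fun s => u s x) t
          + deriv (fun y => deriv (deriv (u t)) y + (u t y) ^ 2 + f2 (u t y)) x = 0) →
      (∀ t, Integrable (fun x => (u t x) ^ 2)) →
      (∀ t, Integrable (fun x => (deriv (u t) x) ^ 2)) →
      (∀ t, Integrable (u t)) →
      (∃ M : ℝ, ∀ t, (∫ x, |u t x|) ≤ M) →
      -- the virial identities (valid thanks to the decay in x of the solution)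
      (∀ ψ : ℝ → ℝ, ContDiff ℝ 3 ψ → (∃ M : ℝ, ∀ n ≤ 3, ∀ x, |iteratedDeriv n ψ x| ≤ M) →
        ∀ t : ℝ, 2 < |t| → HasDerivAt (fun s => ∫ x, ψ (x / lam s) * u s x)
          (-(deriv lam t / lam t) * (∫ x, (x / lam t) * deriv ψ (x / lam t) * u t x)
            + (1 / (lam t) ^ 3) * (∫ x, deriv (deriv (deriv ψ)) (x / lam t) * u t x)
            + (1 / lam t) * ∫ x, deriv ψ (x / lam t) * ((u t x) ^ 2 + f2 (u t x))) t) →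
      (∀ φ : ℝ → ℝ, ContDiff ℝ 3 φ → (∃ M : ℝ, ∀ n ≤ 3, ∀ x, |iteratedDeriv n φ x| ≤ M) →
        ∀ t : ℝ, 2 < |t| → HasDerivAt (fun s => (1/2) * ∫ x, φ (x / lam s) * (u s x) ^ 2)
          (-(deriv lam t / (2 * lam t)) *
              (∫ x, (x / lam t) * deriv φ (x / lam t) * (u t x) ^ 2)
            - (3 / (2 * lam t)) * (∫ x, deriv φ (x / lam t) * (deriv (u t) x) ^ 2)
            + (1 / (2 * (lam t) ^ 3)) *
                (∫ x, deriv (deriv (deriv φ)) (x / lam t) * (u t x) ^ 2)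
            + (1 / lam t) * ∫ x, deriv φ (x / lam t) *
                ((2/3) * (u t x) ^ 3 + u t x * f2 (u t x) - F2 (u t x))) t) →
      -- smallness in H¹, uniformly in time
      (∀ t, Real.sqrt (∫ x, ((u t x) ^ 2 + (deriv (u t) x) ^ 2)) < ε) →
      ∀ C > 0,
        Tendsto (fun t => ∫ x in Set.Ioo (-(C * lam t)) (C * lam t), (u t x) ^ 2)
          atTop (𝓝 0)
        ∧ Tendsto (fun t => ∫ x in Set.Ioo (-(C * lam t)) (C * lam t), (u t x) ^ 2)
          atBot (𝓝 0) := by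
  obtain ⟨ε, hε, hε1, hsmall⟩ := exists_small_nonlinearity hf2.continuous hlim hF20 hF2'
  refine ⟨ε, hε, ?_⟩
  intro u _ hux _ hu2 hux2 hu1 ⟨M, hM⟩ hvir₁ hvir₂ hH1 C hC
  obtain ⟨T, hT9, hT⟩ := exists_lam_bounds
  obtain ⟨ψ, χ, K, hK, hψ, hχ, hψb, hχb, hwc, hw0, hw1, hwK, hχ0, hχw, hχ1, hχd⟩ :=
    exists_virial_weights hC
  have hw : Continuous (deriv ψ) := hψ.continuous_deriv (by norm_num)
  have third : ∀ g : ℝ → ℝ, (∀ n ≤ 3, ∀ x, |iteratedDeriv n g x| ≤ K) →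
      ∀ y, |deriv (deriv (deriv g)) y| ≤ K := by
    intro g hg y
    simpa [iteratedDeriv_succ, iteratedDeriv_zero] using hg 3 le_rfl y
  have hH1' : ∀ t, (∫ x, (u t x ^ 2 + deriv (u t) x ^ 2)) ≤ 1 := fun t =>
    by simpa using (Real.sqrt_le_iff.1 ((hH1 t).le.trans hε1)).2
  have hL2 : ∀ t, (∫ x, u t x ^ 2) ≤ 1 := fun t =>
    (integral_mono (hu2 t) ((hu2 t).add (hux2 t)) fun x =>
      le_add_of_nonneg_right (sq_nonneg _)).trans (hH1' t)
  have hsup : ∀ t x, |u t x| < ε := fun t x => by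
    rw [← Real.sqrt_sq_eq_abs]
    exact (Real.sqrt_le_sqrt (sq_le_integral_sq_add_deriv_sq ((hux t).of_le (by norm_num))
      (hu2 t) (hux2 t) x)).trans_lt (hH1 t)
  have hM0 : 0 ≤ M := (integral_nonneg fun x => abs_nonneg _).trans (hM 0)
  set W := ∫ y, deriv ψ y * y ^ 2
  have hW0 : 0 ≤ W := integral_nonneg fun y => mul_nonneg (hw0 y) (sq_nonneg y)
  set P : ℝ → ℝ := fun s => ∫ x, ψ (x / lam s) * u s x with hP
  set Q : ℝ → ℝ := fun s => (1 / 2) * ∫ x, ψ (x / lam s) * u s x ^ 2 with hQ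
  set J : ℝ → ℝ := fun s => (1 / 2) * ∫ x, χ (x / lam s) * u s x ^ 2 with hJ
  set A : ℝ → ℝ := fun t => ∫ x, deriv ψ (x / lam t) * u t x ^ 2 with hA
  set B : ℝ → ℝ := fun t => ∫ x, deriv ψ (x / lam t) * deriv (u t) x ^ 2 with hB
  have hA0 : ∀ t, 0 ≤ A t := fun t => integral_nonneg fun x => mul_nonneg (hw0 _) (sq_nonneg _)
  have hB0 : ∀ t, 0 ≤ B t := fun t => integral_nonneg fun x => mul_nonneg (hw0 _) (sq_nonneg _)
  set K' := K * M + 3 * W + (K + 1) * (K + 2) + 2 * K with hK'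
  have hKM : 0 ≤ K * M := mul_nonneg hK hM0
  have hKK : 0 ≤ (K + 1) * (K + 2) := by positivity
  have hPd : ∀ t, 2 < |t| → 0 < lam t → HasDerivAt P (deriv P t) t ∧
      (1 / 4) * (A t / lam t) - (deriv lam t ^ 2 * W + K * M / lam t ^ 3) ≤ deriv P t := by
    intro t ht hl
    have h := hvir₁ ψ hψ ⟨K, hψb⟩ t ht
    refine ⟨h.differentiableAt.hasDerivAt, ?_⟩
    rw [h.deriv]
    exact linear_flux_lower_bound hw hwc hw0 hw1 hK (third ψ hψb) hl (hux t).continuous (hu1 t)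
      (hu2 t) (hM t) hf2.continuous fun x => (hsmall _ (hsup t x)).1
  have hQd : ∀ t, 2 < |t| → 0 < lam t → |deriv lam t| ≤ 1 → HasDerivAt Q (deriv Q t) t ∧
      deriv Q t ≤ -(3 / 2) * (B t / lam t) +
        ((K + 1) * (K + 2) * (A t / lam t) + K * (1 / lam t ^ 3)) := by
    intro t ht hl hm
    have h := hvir₂ ψ hψ ⟨K, hψb⟩ t ht
    refine ⟨h.differentiableAt.hasDerivAt, ?_⟩
    rw [h.deriv]
    have e := (abs_le.1 (quadratic_flux_bound (θ := deriv ψ) hw hw0 hw1 hK hwK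
      (fun y => by rw [abs_of_nonneg (hw0 y)]; nlinarith [hw0 y]) (third ψ hψb) hl hm (hu2 t)
      (hL2 t) fun x => (hsmall _ (hsup t x)).2)).2
    have e2 : 3 / (2 * lam t) * B t = 3 / 2 * (B t / lam t) := by field_simp
    linarith
  have hJd : ∀ t, 2 < |t| → 0 < lam t → |deriv lam t| ≤ 1 → HasDerivAt J (deriv J t) t ∧
      |deriv J t| ≤ (K + 1) * (K + 2) * (A t / lam t) + 2 * K * (B t / lam t)
        + K * (1 / lam t ^ 3) := by
    intro t ht hl hm
    have h := hvir₂ χ hχ ⟨K, hχb⟩ t ht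
    refine ⟨h.differentiableAt.hasDerivAt, ?_⟩
    rw [h.deriv]
    have e := abs_le.1 (quadratic_flux_bound (θ := deriv χ) hw hw0 hw1 hK hwK
      (fun y => (hχd y).trans (by nlinarith [hw0 y])) (third χ hχb) hl hm (hu2 t)
      (hL2 t) fun x => (hsmall _ (hsup t x)).2)
    have e1 := abs_integral_weight_le (l := lam t) hw hw0 hw1 hχd (hux2 t)
      fun x => sq_nonneg _
    have e2 : |3 / (2 * lam t) * ∫ x, deriv χ (x / lam t) * deriv (u t) x ^ 2| ≤
        2 * K * (B t / lam t) := by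
      rw [abs_mul, abs_of_pos (by positivity : 0 < 3 / (2 * lam t))]
      calc _ ≤ 3 / (2 * lam t) * (K * B t) := by gcongr
        _ = 3 / 2 * K * (B t / lam t) := by field_simp
        _ ≤ _ := by
          have := div_nonneg (hB0 t) hl.le
          gcongr
          norm_num
    have e3 := abs_le.1 e2
    rw [abs_le]
    constructor <;> linarith
  have hPb : ∀ t, |P t| ≤ K' := fun t =>
    (abs_integral_le_of_bounded (fun y => by simpa using hψb 0 (by norm_num) y) (hu1 t)).trans
      ((mul_le_mul_of_nonneg_left (hM t) hK).trans (by linarith))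
  have habs : ∀ t, (∫ x, |u t x ^ 2|) ≤ 1 := fun t => by simpa using hL2 t
  have hQb : ∀ t, |Q t| ≤ K' := fun t => by
    have := (abs_integral_le_of_bounded (l := lam t)
      (fun y => by simpa using hψb 0 (by norm_num) y) (hu2 t)).trans
      (mul_le_mul_of_nonneg_left (habs t) hK)
    rw [hQ, abs_mul, abs_of_pos (by norm_num : (0 : ℝ) < 1 / 2)]
    linarith
  have hJb : ∀ t, J t ≤ K' := fun t => by
    have := (le_abs_self _).trans ((abs_integral_le_of_bounded (l := lam t)
      (fun y => by simpa using hχb 0 (by norm_num) y) (hu2 t)).trans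
      (mul_le_mul_of_nonneg_left (habs t) hK))
    simp only [hJ]
    linarith
  have hχc := hχ.continuous
  have hχle : ∀ y, χ y ≤ 1 := fun y => (hχw y).trans (hw1 y)
  have hχ2 : ∀ t, 0 ≤ ∫ x, χ (x / lam t) * u t x ^ 2 := fun t =>
    integral_nonneg fun x => mul_nonneg (hχ0 _) (sq_nonneg _)
  have hJA : ∀ t, J t ≤ A t := fun t => by
    have : (∫ x, χ (x / lam t) * u t x ^ 2) ≤ A t :=
      integral_mono (integrable_weight_mul hχc hχ0 hχle (hu2 t))
        (integrable_weight_mul hw hw0 hw1 (hu2 t)) fun x =>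
          mul_le_mul_of_nonneg_right (hχw _) (sq_nonneg _)
    simp only [hJ]
    linarith [hA0 t]
  have key : ∀ σ : ℝ, (σ = 1 ∨ σ = -1) → Tendsto (fun s => J (σ * s)) atTop (𝓝 0) := by
    intro σ hσ
    have hσ2 : σ * σ = 1 := by rcases hσ with rfl | rfl <;> norm_num
    have hσa : |σ| = 1 := by rcases hσ with rfl | rfl <;> norm_num
    have hlσ : ∀ s, lam (σ * s) = lam s := by
      intro s; rcases hσ with rfl | rfl <;> simp [lam_neg]
    have hdσ : ∀ s, |deriv lam (σ * s)| = |deriv lam s| := by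
      intro s; rcases hσ with rfl | rfl <;> simp [deriv_lam_neg]
    have hcomp : ∀ (g : ℝ → ℝ) (g' s : ℝ), HasDerivAt g g' (σ * s) →
        HasDerivAt (fun s => g (σ * s)) (g' * σ) s := fun g g' s h =>
      (HasDerivAt.comp s h ((hasDerivAt_id s).const_mul σ)).congr_deriv (by simp)
    have h2 : ∀ s, T < s → 2 < |σ * s| := fun s hs => by
      rw [abs_mul, hσa, one_mul, abs_of_pos (by linarith)]; linarith
    have hl0 : ∀ s, T < s → 0 < lam (σ * s) := fun s hs => by
      rw [hlσ]; exact (hT s hs).2.1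
    have hm1 : ∀ s, T < s → |deriv lam (σ * s)| ≤ 1 := fun s hs => by
      rw [hdσ]; exact (hT s hs).2.2.2.1
    have hm2 : ∀ s, T < s →
        deriv lam (σ * s) ^ 2 ≤ 3 * (1 / (s * Real.log s ^ 2)) := fun s hs => by
      rw [← sq_abs, hdσ, sq_abs]; exact (hT s hs).2.2.2.2.1
    have hl3 : ∀ s, T < s → 1 / lam (σ * s) ^ 3 ≤ 1 / (s * Real.log s ^ 2) := fun s hs => by
      rw [hlσ]; exact (hT s hs).2.2.2.2.2
    have hAl : ∀ s, T < s → 0 ≤ A (σ * s) / lam (σ * s) := fun s hs =>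
      div_nonneg (hA0 _) (hl0 s hs).le
    have hBl : ∀ s, T < s → 0 ≤ B (σ * s) / lam (σ * s) := fun s hs =>
      div_nonneg (hB0 _) (hl0 s hs).le
    have hG0 : ∀ s, T < s → 0 ≤ 1 / (s * Real.log s ^ 2) := fun s hs => by
      have : 0 < s := by linarith
      positivity
    refine tendsto_zero_of_virial_inequalities (p := fun s => σ * P (σ * s))
      (q := fun s => σ * Q (σ * s)) (p' := fun s => deriv P (σ * s))
      (q' := fun s => deriv Q (σ * s)) (j' := fun s => deriv J (σ * s) * σ)
      (a := fun s => A (σ * s) / lam (σ * s)) (b := fun s => B (σ * s) / lam (σ * s))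
      (K := K') hT9 (by positivity) ?_ ?_ ?_ (fun s hs => (hT s hs).1) hBl ?_ ?_ ?_ ?_ ?_ ?_
      (fun s _ => hJb _) ?_
    · intro s hs
      refine ((hcomp _ _ s (hPd _ (h2 s hs) (hl0 s hs)).1).const_mul σ).congr_deriv ?_
      rw [mul_left_comm, hσ2, mul_one]
    · intro s hs
      refine ((hcomp _ _ s (hQd _ (h2 s hs) (hl0 s hs) (hm1 s hs)).1).const_mul σ).congr_deriv ?_
      rw [mul_left_comm, hσ2, mul_one]
    · intro s hs
      exact hcomp _ _ s (hJd _ (h2 s hs) (hl0 s hs) (hm1 s hs)).1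
    · intro s hs
      have e := (hPd _ (h2 s hs) (hl0 s hs)).2
      have e1 := mul_le_mul_of_nonneg_right (hm2 s hs) hW0
      have e2 := mul_le_mul_of_nonneg_left (hl3 s hs) hKM
      have e3 := mul_nonneg (add_nonneg hKK (by linarith : 0 ≤ 2 * K)) (hG0 s hs)
      have e4 : K * M / lam (σ * s) ^ 3 = K * M * (1 / lam (σ * s) ^ 3) := by ring
      rw [div_eq_mul_one_div K', hK']
      linarith
    · intro s hs
      have e := (hQd _ (h2 s hs) (hl0 s hs) (hm1 s hs)).2
      have e1 := mul_le_mul_of_nonneg_left (hl3 s hs) hK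
      have e2 := mul_nonneg (by linarith : 0 ≤ K * M + 3 * W + 2 * K) (hAl s hs)
      have e3 := mul_nonneg (by linarith : 0 ≤ K * M + 3 * W + (K + 1) * (K + 2) + K) (hG0 s hs)
      rw [div_eq_mul_one_div K', hK']
      linarith
    · intro s hs
      have e := (hJd _ (h2 s hs) (hl0 s hs) (hm1 s hs)).2
      have e1 := mul_le_mul_of_nonneg_left (hl3 s hs) hK
      have e2 := mul_nonneg (by linarith : 0 ≤ K * M + 3 * W + 2 * K) (hAl s hs)
      have e3 := mul_nonneg (by linarith : 0 ≤ K * M + 3 * W + (K + 1) * (K + 2) + K) (hG0 s hs)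
      have e4 := mul_nonneg (by linarith : 0 ≤ K * M + 3 * W + (K + 1) * (K + 2)) (hBl s hs)
      rw [abs_mul, hσa, mul_one, div_eq_mul_one_div K', hK']
      linarith
    · intro s _
      simpa only [abs_mul, hσa, one_mul] using hPb (σ * s)
    · intro s _
      simpa only [abs_mul, hσa, one_mul] using hQb (σ * s)
    · intro s _
      exact mul_nonneg (by norm_num) (hχ2 _)
    · intro s hs
      exact div_le_div₀ (hA0 _) (hJA _) (hl0 s hs) (by rw [hlσ]; exact (hT s hs).2.2.1)
  have hle : ∀ t, 0 < lam t →
      (∫ x in Set.Ioo (-(C * lam t)) (C * lam t), u t x ^ 2) ≤ 2 * J t := by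
    intro t hl
    have e : (∫ x in Set.Ioo (-(C * lam t)) (C * lam t), u t x ^ 2) =
        ∫ x in Set.Ioo (-(C * lam t)) (C * lam t), χ (x / lam t) * u t x ^ 2 := by
      refine setIntegral_congr_fun measurableSet_Ioo fun x hx => ?_
      have : |x / lam t| < C := by
        rw [abs_div, abs_of_pos hl, div_lt_iff₀ hl]
        exact abs_lt.2 hx
      simp only [hχ1 _ this, one_mul]
    rw [e]
    refine (setIntegral_le_integral (integrable_weight_mul hχc hχ0 hχle (hu2 t))
      (ae_of_all _ fun x => mul_nonneg (hχ0 _) (sq_nonneg _))).trans_eq ?_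
    simp only [hJ]
    ring
  have concl : ∀ σ : ℝ, (σ = 1 ∨ σ = -1) → Tendsto (fun s =>
      ∫ x in Set.Ioo (-(C * lam (σ * s))) (C * lam (σ * s)), u (σ * s) x ^ 2) atTop (𝓝 0) := by
    intro σ hσ
    refine squeeze_zero' (Eventually.of_forall fun s => integral_nonneg fun x => sq_nonneg _) ?_
      (by simpa using (key σ hσ).const_mul 2)
    filter_upwards [eventually_gt_atTop T] with s hs
    refine hle _ ?_
    have := (hT s hs).2.1
    rcases hσ with rfl | rfl <;> simpa [lam_neg] using this
  refine ⟨by simpa using concl 1 (Or.inl rfl), ?_⟩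
  refine ((concl (-1) (Or.inr rfl)).comp tendsto_neg_atBot_atTop).congr fun t => ?_
  simp
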